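/- arXiv:2112.10182 — 2 statements merged into one kernel-verified Lean document; each statement's English description precedes it below -/
import Mathlib

section
/- Let V be a ℚ-vector space and let ψ₁, ψ₂, κ, δ_sep, δ_nonsep ∈ V. Suppose that for every integer r ≥ 3 both relations (r-1)[P_1(r,1)ψ₁ + P_1(r,0)ψ₂] − ((r-1)(r-2)/24)·δ_nonsep − (r-1)P_1(r,1)·δ_sep − (r-1)P_1(r,0)·κ = 0 and (r-1)[P_1(r,0)ψ₁ + P_1(r,1)ψ₂] − ((r-1)(r-2)/24)·δ_nonsep − (r-1)P_1(r,1)·δ_sep − (r-1)P_1(r,0)·κ = 0 hold in V. Then ψ₁ = ψ₂, 2ψ₁ = δ_sep + κ, and ψ₁ = (1/12)δ_nonsep + δ_sep. -/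
/-- The degree-one coefficients `P_1(r,a)` of the inverse R-matrix of the shifted
Witten `r`-spin CohFT. -/
def P₁ (r a : ℤ) : ℚ :=
  (1 / 2 : ℚ) * (a : ℚ) * ((r : ℚ) - 1 - (a : ℚ))
    - (1 / 24 : ℚ) * (2 * (r : ℚ) - 1) * ((r : ℚ) - 2)

/-- The PPZ `r`-spin relations in `H²(M̄_{1,2},ℚ)` for the insertion tuples `(1,0)` and
`(0,1)` imply the Arbarello–Cornalba relations `ψ₁ = ψ₂`, `2ψ₁ = δ_sep + κ₁`,
`ψ₁ = (1/12)δ_nonsep + δ_sep`. -/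
theorem genus_one_two_points_relations
    (V : Type*) [AddCommGroup V] [Module ℚ V]
    (ψ₁ ψ₂ κ δsep δnonsep : V)
    (h₁ : ∀ r : ℤ, 3 ≤ r →
      ((r : ℚ) - 1) • (P₁ r 1 • ψ₁ + P₁ r 0 • ψ₂)
        - (((r : ℚ) - 1) * ((r : ℚ) - 2) / 24) • δnonsep
        - (((r : ℚ) - 1) * P₁ r 1) • δsep
        - (((r : ℚ) - 1) * P₁ r 0) • κ = 0)
    (h₂ : ∀ r : ℤ, 3 ≤ r →
      ((r : ℚ) - 1) • (P₁ r 0 • ψ₁ + P₁ r 1 • ψ₂)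
        - (((r : ℚ) - 1) * ((r : ℚ) - 2) / 24) • δnonsep
        - (((r : ℚ) - 1) * P₁ r 1) • δsep
        - (((r : ℚ) - 1) * P₁ r 0) • κ = 0) :
    ψ₁ = ψ₂ ∧ (2 : ℚ) • ψ₁ = δsep + κ ∧ ψ₁ = (1 / 12 : ℚ) • δnonsep + δsep := by
  have h₁₃ := h₁ 3 (by norm_num)
  have h₁₄ := h₁ 4 (by norm_num)
  have h₂₃ := h₂ 3 (by norm_num)
  norm_num [P₁] at h₁₃ h₁₄ h₂₃
  have hψ : ψ₁ = ψ₂ := by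
    linear_combination (norm := module) h₁₃ - h₂₃
  refine ⟨hψ, ?_, ?_⟩
  · linear_combination (norm := module) (6 : ℚ) • h₁₃ - (2 : ℚ) • h₁₄ + hψ
  · linear_combination (norm := module) (7 / 2 : ℚ) • h₁₃ - (5 / 6 : ℚ) • h₁₄
end

section
/- For every integer r ≥ 3 and every n ≥ 1, the (n+1)×(n+1) matrix M over ℚ with entries M_{ii} = (r−1)P_1(r,1) for 1 ≤ i ≤ n, M_{ij} = (r−1)P_1(r,0) for 1 ≤ i ≠ j ≤ n, M_{i,n+1} = −(r−1)P_1(r,0) for 1 ≤ i ≤ n, M_{n+1,j} = 1 for 1 ≤ j ≤ n, and M_{n+1,n+1} = −1 satisfies det M = −((r−1)(r−2)/2)^n. In particular det M ≠ 0, so M is invertible. -/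
/-- A matrix with constant diagonal block entries `b + c`, off-diagonal block entries `b`,
last column `-b`, and last row `(1, …, 1, -1)` has determinant `-cⁿ`. -/
theorem det_bordered_const_add_scalar {R : Type*} [CommRing R] (n : ℕ) (b c : R)
    (M : Matrix (Fin (n + 1)) (Fin (n + 1)) R)
    (hM : ∀ i j : Fin (n + 1),
      M i j =
        if i.val < n then
          (if j.val < n then (if i = j then b + c else b) else -b)
        else
          (if j.val < n then 1 else -1)) :
    M.det = -c ^ n := by
  let N : Matrix (Fin (n + 1)) (Fin (n + 1)) R := fun i j =>
    if i.val < n then (if i = j then c else 0) else (if j.val < n then 1 else -1)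
  have hMN : M.det = N.det := by
    refine Matrix.det_eq_of_forall_row_eq_smul_add_const
      (fun i => if i.val < n then b else 0) (Fin.last n) (by simp) fun i j => ?_
    rw [hM]
    by_cases hij : i = j
    · subst hij
      by_cases hi : i.val < n <;> simp [N, hi, add_comm]
    · by_cases hi : i.val < n <;> by_cases hj : j.val < n <;> simp [N, hi, hj, hij]
  have hN : N.BlockTriangular OrderDual.toDual := by
    intro i j hij
    have hlt : i < j := hij
    have hi : i.val < n := by have := j.isLt; omega
    simp [N, hi, hlt.ne]
  rw [hMN, Matrix.det_of_isLowerTriangular N hN, Fin.prod_univ_castSucc]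
  simp [N]

/-- For `r ≥ 3`, the coefficient matrix of the genus 1 PPZ relations in the unknowns
`ψ₁,…,ψ_n, κ₁` has determinant `−((r−1)(r−2)/2)ⁿ ≠ 0`; in particular it is invertible. -/
theorem det_ppz_matrix_nonzero
    (r : ℤ) (hr : 3 ≤ r) (n : ℕ) (hn : 1 ≤ n)
    (M : Matrix (Fin (n + 1)) (Fin (n + 1)) ℚ)
    (hM : ∀ i j : Fin (n + 1),
      M i j =
        if i.val < n then
          (if j.val < n then
            (if i = j then ((r : ℚ) - 1) * P₁ r 1 else ((r : ℚ) - 1) * P₁ r 0)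
          else -(((r : ℚ) - 1) * P₁ r 0))
        else
          (if j.val < n then 1 else -1)) :
    M.det = -((((r : ℚ) - 1) * ((r : ℚ) - 2) / 2) ^ n) ∧ M.det ≠ 0 ∧ IsUnit M := by
  have hdiff : ((r : ℚ) - 1) * P₁ r 1 =
      ((r : ℚ) - 1) * P₁ r 0 + ((r : ℚ) - 1) * ((r : ℚ) - 2) / 2 := by
    simp only [P₁]
    push_cast
    ring
  have hdet : M.det = -((((r : ℚ) - 1) * ((r : ℚ) - 2) / 2) ^ n) :=
    det_bordered_const_add_scalar n (((r : ℚ) - 1) * P₁ r 0) _ M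
      fun i j => by rw [hM, hdiff]
  have hr' : (3 : ℚ) ≤ r := by exact_mod_cast hr
  have hne : M.det ≠ 0 := by
    rw [hdet]
    have h₁ : (0 : ℚ) < r - 1 := by linarith
    have h₂ : (0 : ℚ) < r - 2 := by linarith
    exact neg_ne_zero.mpr (by positivity)
  exact ⟨hdet, hne, (Matrix.isUnit_iff_isUnit_det M).mpr hne.isUnit⟩
end
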